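/- For commutative rings R and S and an integer n ≥ 0, the product ring R × S is n-perfect if and only if both R and S are n-perfect; equivalently cot.D(R × S) = max{cot.D(R), cot.D(S)}. -/

import Mathlib

open CategoryTheory Opposite

noncomputable section

universe u

variable (R : Type u) [CommRing R]

/-- `ExtVanish R M N n` : the `n`-th Ext group `Ext^n_R(M, N)` vanishes. -/
def ExtVanish (M N : ModuleCat.{u} R) (n : ℕ) : Prop :=
  Subsingleton (((Ext R (ModuleCat.{u} R) n).obj (op M)).obj N)

/-- `TorVanish R M N n` : the `n`-th Tor group `Tor_n^R(M, N)` vanishes. -/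
def TorVanish (M N : ModuleCat.{u} R) (n : ℕ) : Prop :=
  Subsingleton (((Tor (ModuleCat.{u} R) n).obj M).obj N)

/-- `pdLE R M n` : the projective dimension of `M` is at most `n`. -/
def pdLE (M : ModuleCat.{u} R) (n : ℕ) : Prop :=
  ∀ N : ModuleCat.{u} R, ExtVanish R M N (n + 1)

/-- `idLE R M n` : the injective dimension of `M` is at most `n`. -/
def idLE (M : ModuleCat.{u} R) (n : ℕ) : Prop :=
  ∀ N : ModuleCat.{u} R, ExtVanish R N M (n + 1)

/-- `fdLE R M n` : the flat dimension of `M` is at most `n`. -/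
def fdLE (M : ModuleCat.{u} R) (n : ℕ) : Prop :=
  ∀ N : ModuleCat.{u} R, TorVanish R M N (n + 1)

/-- `cdLE R M n` : the cotorsion dimension of `M` is at most `n`, i.e.
`Ext^{n+1}_R(F, M) = 0` for every flat `R`-module `F`. -/
def cdLE (M : ModuleCat.{u} R) (n : ℕ) : Prop :=
  ∀ F : ModuleCat.{u} R, Module.Flat R F → ExtVanish R F M (n + 1)

/-- The projective dimension of a module, as an element of `ℕ∞`. -/
def pd (M : ModuleCat.{u} R) : ℕ∞ := sInf ((↑) '' {n : ℕ | pdLE R M n})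

/-- The injective dimension of a module, as an element of `ℕ∞`. -/
def injd (M : ModuleCat.{u} R) : ℕ∞ := sInf ((↑) '' {n : ℕ | idLE R M n})

/-- The flat dimension of a module, as an element of `ℕ∞`. -/
def fd (M : ModuleCat.{u} R) : ℕ∞ := sInf ((↑) '' {n : ℕ | fdLE R M n})

/-- The cotorsion dimension of a module, as an element of `ℕ∞`. -/
def cd (M : ModuleCat.{u} R) : ℕ∞ := sInf ((↑) '' {n : ℕ | cdLE R M n})

/-- The global dimension of a ring. -/
def gldim : ℕ∞ := ⨆ M : ModuleCat.{u} R, pd R M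

/-- The weak global dimension of a ring. -/
def wdim : ℕ∞ := ⨆ M : ModuleCat.{u} R, fd R M

/-- The global cotorsion dimension of a ring: the supremum of the projective
dimensions of all flat modules. -/
def cotD : ℕ∞ := ⨆ (M : ModuleCat.{u} R) (_ : Module.Flat R M), pd R M

/-- The finitistic projective dimension of a ring. -/
def FPD : ℕ∞ := sSup {d : ℕ∞ | d ≠ ⊤ ∧ ∃ M : ModuleCat.{u} R, pd R M = d}

/-- The finitistic flat dimension of a ring. -/
def FFD : ℕ∞ := sSup {d : ℕ∞ | d ≠ ⊤ ∧ ∃ M : ModuleCat.{u} R, fd R M = d}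

/-- The finitistic injective dimension of a ring. -/
def FID : ℕ∞ := sSup {d : ℕ∞ | d ≠ ⊤ ∧ ∃ M : ModuleCat.{u} R, injd R M = d}

/-- The finitistic cotorsion dimension of a ring. -/
def FCD : ℕ∞ := sSup {d : ℕ∞ | d ≠ ⊤ ∧ ∃ M : ModuleCat.{u} R, cd R M = d}

/-- `R` is `n`-perfect if every flat `R`-module has projective dimension at most `n`. -/
def IsNPerfect (n : ℕ) : Prop :=
  ∀ M : ModuleCat.{u} R, Module.Flat R M → pd R M ≤ n

end

section helpers
open CategoryTheory TensorProduct

/-- `Ext` vanishing in terms of a projective resolution. -/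
lemma extVanish_iff {R : Type u} [CommRing R] {M : ModuleCat.{u} R} (P : ProjectiveResolution M)
    (N : ModuleCat.{u} R) (n : ℕ) :
    ExtVanish R M N (n + 1) ↔ ∀ f : P.complex.X (n + 1) ⟶ N,
      P.complex.d (n + 2) (n + 1) ≫ f = 0 →
        ∃ g : P.complex.X n ⟶ N, P.complex.d (n + 1) n ≫ g = f := by
  unfold ExtVanish
  rw [← ModuleCat.isZero_iff_subsingleton, (P.isoExt (R := R) (n + 1) N).isZero_iff,
    ← HomologicalComplex.exactAt_iff_isZero_homology,
    HomologicalComplex.exactAt_iff' _ n (n + 1) (n + 2) (by simp) (by simp),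
    ShortComplex.moduleCat_exact_iff]
  rfl

lemma pdLE_iff {R : Type u} [CommRing R] (M : ModuleCat.{u} R) (n : ℕ) :
    pdLE R M n ↔ HasProjectiveDimensionLE M n := by
  let P := projectiveResolution M
  constructor
  · intro h
    refine hasProjectiveDimensionLT_of_enoughInjectives M (n + 1) fun N => ?_
    refine subsingleton_of_forall_eq 0 fun e => ?_
    obtain ⟨f, hf, rfl⟩ := P.extMk_surjective e (n + 2) rfl
    rw [P.extMk_eq_zero_iff f (n + 2) rfl hf n rfl]
    exact (extVanish_iff P N n).1 (h N) f hf
  · intro h N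
    rw [extVanish_iff P]
    intro f hf
    rw [← P.extMk_eq_zero_iff f (n + 2) rfl hf n rfl]
    have := HasProjectiveDimensionLT.subsingleton M (n + 1) (n + 1) le_rfl N
    exact Subsingleton.elim _ _

lemma pd_le_iff {R : Type u} [CommRing R] (M : ModuleCat.{u} R) (n : ℕ) :
    pd R M ≤ n ↔ HasProjectiveDimensionLE M n := by
  constructor
  · intro h
    have h2 : pd R M < (n + 1 : ℕ) := lt_of_le_of_lt h (by exact_mod_cast Nat.lt_succ_self n)
    obtain ⟨_, ⟨m, hm, rfl⟩, hlt⟩ := sInf_lt_iff.1 h2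
    have hmn : m < n + 1 := by exact_mod_cast hlt
    have := (pdLE_iff M m).1 hm
    exact hasProjectiveDimensionLT_of_ge M (m + 1) (n + 1) (by omega)
  · intro h
    exact sInf_le ⟨n, (pdLE_iff M n).2 h, rfl⟩

lemma cotD_le_iff (R : Type u) [CommRing R] (n : ℕ) :
    cotD R ≤ n ↔ IsNPerfect R n := by
  simp only [cotD, IsNPerfect, iSup_le_iff]

/-- Transport of projective dimension along an exact functor preserving projectives, in the
concrete form of base change. -/
lemma pd_baseChange {A B : Type u} [CommRing A] [CommRing B] [Algebra A B] [Module.Flat A B]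
    (n : ℕ) (M : ModuleCat.{u} A) (h : HasProjectiveDimensionLE M n) :
    HasProjectiveDimensionLE (ModuleCat.of B (B ⊗[A] M)) n := by
  induction n generalizing M with
  | zero =>
    rw [← projective_iff_hasProjectiveDimensionLE_zero, ← IsProjective.iff_projective] at h ⊢
    infer_instance
  | succ n ih =>
    let T := M.projectiveShortComplex
    have hT : T.ShortExact := M.shortExact_projectiveShortComplex
    have hex := (ShortComplex.ShortExact.moduleCat_exact_iff_function_exact T).1 hT.exact
    let T' := ShortComplex.moduleCatMk (T.f.hom.baseChange B) (T.g.hom.baseChange B) (by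
      rw [← LinearMap.baseChange_comp, hex.linearMap_comp_eq_zero, LinearMap.baseChange_zero])
    have hT' : T'.ShortExact :=
      { exact := (ShortComplex.ShortExact.moduleCat_exact_iff_function_exact T').2
          (lTensor_exact B hex hT.moduleCat_surjective_g)
        mono_f := (ModuleCat.mono_iff_injective _).2
          (Module.Flat.lTensor_preserves_injective_linearMap T.f.hom hT.moduleCat_injective_f)
        epi_g := (ModuleCat.epi_iff_surjective _).2
          (LinearMap.lTensor_surjective B hT.moduleCat_surjective_g) }
    have hP : Projective T'.X₂ := by
      rw [← IsProjective.iff_projective]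
      change Module.Projective B (B ⊗[A] T.X₂)
      infer_instance
    have h1 := (hT.hasProjectiveDimensionLT_X₃_iff n inferInstance).1 h
    exact (hT'.hasProjectiveDimensionLT_X₃_iff n hP).2 (ih _ h1)

lemma projective_restrict {A B : Type u} [CommRing A] [CommRing B] [Algebra A B]
    [Module.Projective A B] (N : Type u) [AddCommGroup N] [Module B N] [Module A N]
    [IsScalarTower A B N] [Module.Projective B N] : Module.Projective A N := by
  obtain ⟨s, hs⟩ := Module.projective_def'.1 (‹Module.Projective B N›)
  classical
  have : Module.Projective A (N →₀ B) :=
    Module.Projective.of_equiv' (finsuppLequivDFinsupp A (ι := N) (M := B)).symm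
  refine Module.Projective.of_split (s.restrictScalars A)
    ((Finsupp.linearCombination B (id : N → N)).restrictScalars A) ?_
  ext x
  exact LinearMap.congr_fun hs x

lemma pd_restrict {A B : Type u} [CommRing A] [CommRing B] [Algebra A B] [Module.Projective A B]
    (n : ℕ) (N : ModuleCat.{u} B) [Module A N] [IsScalarTower A B N]
    (h : HasProjectiveDimensionLE N n) :
    HasProjectiveDimensionLE (ModuleCat.of A N) n := by
  induction n generalizing N with
  | zero =>
    rw [← projective_iff_hasProjectiveDimensionLE_zero, ← IsProjective.iff_projective] at h ⊢
    exact projective_restrict (B := B) N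
  | succ n ih =>
    let g : (N →₀ B) →ₗ[B] N := Finsupp.linearCombination B (id : N → N)
    have hg : Function.Surjective g := fun x => ⟨Finsupp.single x 1, by simp [g]⟩
    have hPA : Module.Projective A (N →₀ B) := by
      classical
      exact Module.Projective.of_equiv' (finsuppLequivDFinsupp A (ι := N) (M := B)).symm
    have h0 : g.comp (LinearMap.ker g).subtype = 0 := LinearMap.ext fun x => x.2
    have h0' : (g.restrictScalars A).comp ((LinearMap.ker g).subtype.restrictScalars A) = 0 :=
      LinearMap.ext fun x => x.2
    let T := ShortComplex.moduleCatMk (X₁ := LinearMap.ker g) (LinearMap.ker g).subtype g h0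
    have hT : T.ShortExact :=
      { exact := (ShortComplex.ShortExact.moduleCat_exact_iff_function_exact T).2
          (LinearMap.exact_subtype_ker_map g)
        mono_f := (ModuleCat.mono_iff_injective _).2 (LinearMap.ker g).subtype_injective
        epi_g := (ModuleCat.epi_iff_surjective _).2 hg }
    let T' := ShortComplex.moduleCatMk (X₁ := LinearMap.ker g)
      ((LinearMap.ker g).subtype.restrictScalars A) (g.restrictScalars A) h0'
    have hT' : T'.ShortExact :=
      { exact := (ShortComplex.ShortExact.moduleCat_exact_iff_function_exact T').2
          (LinearMap.exact_subtype_ker_map g)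
        mono_f := (ModuleCat.mono_iff_injective _).2 (LinearMap.ker g).subtype_injective
        epi_g := (ModuleCat.epi_iff_surjective _).2 hg }
    have hP0 : Projective T.X₂ := by
      rw [← IsProjective.iff_projective]
      change Module.Projective B (N →₀ B)
      infer_instance
    have hP : Projective T'.X₂ := by
      rw [← IsProjective.iff_projective]
      exact hPA
    have h1 := (hT.hasProjectiveDimensionLT_X₃_iff n hP0).1 h
    exact (hT'.hasProjectiveDimensionLT_X₃_iff n hP).2
      (ih (ModuleCat.of B (LinearMap.ker g)) h1)

/-- `n`-perfectness passes to a projective quotient algebra. -/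
lemma nPerfect_of_surjective {A B : Type u} [CommRing A] [CommRing B] [Algebra A B]
    [Module.Projective A B] (hs : Function.Surjective (algebraMap A B)) (n : ℕ)
    (h : IsNPerfect A n) : IsNPerfect B n := by
  intro M hM
  rw [pd_le_iff]
  let : Module A M := Module.compHom _ (algebraMap A B)
  have : IsScalarTower A B M := IsScalarTower.of_algebraMap_smul fun _ _ => rfl
  have hf : Module.Flat A M := Module.Flat.trans A B M
  have h1 := pd_baseChange (B := B) n _ ((pd_le_iff _ n).1 (h (ModuleCat.of A M) hf))
  have : TensorProduct.CompatibleSMul A B B M := ⟨fun b x m => by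
    obtain ⟨a, rfl⟩ := hs b
    rw [algebraMap_smul, algebraMap_smul, TensorProduct.smul_tmul]⟩
  exact ModuleCat.hasProjectiveDimensionLE_of_linearEquiv
    (M := ModuleCat.of B (B ⊗[A] M)) (TensorProduct.lidOfCompatibleSMul A B M) n

/-- Restricting the base change back. -/
lemma pd_restrict_baseChange {A B : Type u} [CommRing A] [CommRing B] [Algebra A B]
    [Module.Projective A B] (n : ℕ) (h : IsNPerfect B n) (M : ModuleCat.{u} A)
    (hM : Module.Flat A M) : HasProjectiveDimensionLE (ModuleCat.of A (B ⊗[A] M)) n :=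
  pd_restrict (B := B) n (ModuleCat.of B (B ⊗[A] M))
    ((pd_le_iff _ n).1 (h (ModuleCat.of B (B ⊗[A] M)) (Module.Flat.baseChange A B M)))

lemma nPerfect_prod_iff (R S : Type u) [CommRing R] [CommRing S] (n : ℕ) :
    IsNPerfect (R × S) n ↔ IsNPerfect R n ∧ IsNPerfect S n := by
  let : Algebra (R × S) R := (RingHom.fst R S).toAlgebra
  let : Algebra (R × S) S := (RingHom.snd R S).toAlgebra
  have : Module.Projective (R × S) R := Module.Projective.of_split
    (M := R × S)
    { toFun := fun r => (r, 0)
      map_add' := fun _ _ => by simp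
      map_smul' := fun a r => Prod.ext rfl (mul_zero a.2).symm }
    { toFun := fun x => x.1, map_add' := fun _ _ => rfl, map_smul' := fun _ _ => rfl }
    (LinearMap.ext fun _ => rfl)
  have : Module.Projective (R × S) S := Module.Projective.of_split
    (M := R × S)
    { toFun := fun s => (0, s)
      map_add' := fun _ _ => by simp
      map_smul' := fun a r => Prod.ext (mul_zero a.1).symm rfl }
    { toFun := fun x => x.2, map_add' := fun _ _ => rfl, map_smul' := fun _ _ => rfl }
    (LinearMap.ext fun _ => rfl)
  constructor
  · intro h
    exact ⟨nPerfect_of_surjective (A := R × S) (B := R) (fun r => ⟨(r, 0), rfl⟩) n h,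
      nPerfect_of_surjective (A := R × S) (B := S) (fun s => ⟨(0, s), rfl⟩) n h⟩
  · rintro ⟨hR, hS⟩ M hM
    rw [pd_le_iff]
    have h1 := pd_restrict_baseChange (A := R × S) n hR M hM
    have h2 := pd_restrict_baseChange (A := R × S) n hS M hM
    let i := LinearMap.inl (R × S) (R ⊗[R × S] M) (S ⊗[R × S] M)
    let p := LinearMap.snd (R × S) (R ⊗[R × S] M) (S ⊗[R × S] M)
    have hi : Function.Injective i := LinearMap.inl_injective
    have hp : Function.Surjective p := LinearMap.snd_surjective
    have hip : Function.Exact i p := Function.Exact.inl_snd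
    let T := ShortComplex.moduleCatMk i p hip.linearMap_comp_eq_zero
    have hT : T.ShortExact :=
      { exact := (ShortComplex.ShortExact.moduleCat_exact_iff_function_exact T).2 hip
        mono_f := (ModuleCat.mono_iff_injective _).2 hi
        epi_g := (ModuleCat.epi_iff_surjective _).2 hp }
    have h3 : HasProjectiveDimensionLE T.X₂ n := hT.hasProjectiveDimensionLT_X₂ (n + 1) h1 h2
    let e1 : @LinearEquiv (R × S) (R × S) _ _ (RingHom.id _) (RingHom.id _) _ _ (R × S) (R × S) _ _
        Semiring.toModule Prod.instModule :=
      { toFun := id, invFun := id, left_inv := fun _ => rfl, right_inv := fun _ => rfl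
        map_add' := fun _ _ => rfl, map_smul' := fun _ _ => rfl }
    let e : M ≃ₗ[R × S] (R ⊗[R × S] M) × (S ⊗[R × S] M) :=
      (TensorProduct.lid (R × S) M).symm ≪≫ₗ TensorProduct.congr e1 (LinearEquiv.refl _ _) ≪≫ₗ
        TensorProduct.prodLeft (R × S) (R × S) R S M
    exact ModuleCat.hasProjectiveDimensionLE_of_linearEquiv (M := T.X₂) e.symm n

end helpers

/-- `R × S` is `n`-perfect iff both `R` and `S` are; equivalently
`cot.D (R × S) = max (cot.D R) (cot.D S)`. -/
theorem stmt_14 (R S : Type u) [CommRing R] [CommRing S] (n : ℕ) :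
    (IsNPerfect (R × S) n ↔ IsNPerfect R n ∧ IsNPerfect S n) ∧
    cotD (R × S) = max (cotD R) (cotD S) := by
  refine ⟨nPerfect_prod_iff R S n, ?_⟩
  refine eq_of_forall_ge_iff fun c => ?_
  induction c using ENat.recTopCoe with
  | top => simp
  | coe m => rw [max_le_iff, cotD_le_iff, cotD_le_iff, cotD_le_iff, nPerfect_prod_iff]
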